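/- In the US legislative game, for every power index Φ (given by a weighting vector on n = 537 players) such that Φ(P) ≠ 0 and Φ(S) ≠ 0 for a senator S, and for every representative R: Φ(P) > Φ(S), Φ(S) > Φ(R), and Φ(S) ≥ Φ(V). -/

import Mathlib

/-- The players of the US legislative game: the president, the vice president,
100 senators, and 435 representatives. -/
inductive USPlayer where
  | pres : USPlayer
  | vp : USPlayer
  | sen : Fin 100 → USPlayer
  | rep : Fin 435 → USPlayer
  deriving DecidableEq

/-- Whether a player is a senator. -/
def USPlayer.isSen : USPlayer → Bool
  | .sen _ => true
  | _ => false

/-- Whether a player is a representative. -/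
def USPlayer.isRep : USPlayer → Bool
  | .rep _ => true
  | _ => false

/-- The number of senators in a coalition. -/
def numSen (S : Finset USPlayer) : ℕ := (S.filter (fun p => p.isSen)).card

/-- The number of representatives in a coalition. -/
def numRep (S : Finset USPlayer) : ℕ := (S.filter (fun p => p.isRep)).card

/-- A coalition is winning in the US legislative game iff either the president is in it
together with at least 218 representatives and either at least 51 senators or the vice
president and at least 50 senators; or it contains at least 67 senators and at least
290 representatives (veto override). -/
def usWinning (S : Finset USPlayer) : Prop :=
  (USPlayer.pres ∈ S ∧ 218 ≤ numRep S ∧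
    (51 ≤ numSen S ∨ (USPlayer.vp ∈ S ∧ 50 ≤ numSen S))) ∨
  (67 ≤ numSen S ∧ 290 ≤ numRep S)

/-- The number of coalitions of size `k` in which player `i` is critical in the US
legislative game. -/
noncomputable def usCrit (i : USPlayer) (k : ℕ) : ℕ :=
  Set.ncard {S : Finset USPlayer |
    S.card = k ∧ i ∈ S ∧ usWinning S ∧ ¬ usWinning (S.erase i)}
/-- The power of player `i` under the power index with weighting vector `lam` on the
537-player US legislative game. -/
noncomputable def usPower (lam : ℕ → ℝ) (i : USPlayer) : ℝ :=
  ∑ k ∈ Finset.Icc 1 537, lam k * (usCrit i k : ℝ)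

namespace USPlayer

/-- The coalition with prescribed president, vice president, senators and representatives. -/
def coalition (x : Bool × Bool × Finset (Fin 100) × Finset (Fin 435)) : Finset USPlayer :=
  (((if x.1 then {pres} else ∅) ∪ (if x.2.1 then {vp} else ∅)) ∪ x.2.2.1.image sen) ∪
    x.2.2.2.image rep

theorem pres_mem_coalition (p v A B) : pres ∈ coalition (p, v, A, B) ↔ p = true := by
  cases p <;> cases v <;> simp [coalition]

theorem vp_mem_coalition (p v A B) : vp ∈ coalition (p, v, A, B) ↔ v = true := by
  cases p <;> cases v <;> simp [coalition]

theorem sen_mem_coalition (p v A B s) : sen s ∈ coalition (p, v, A, B) ↔ s ∈ A := by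
  cases p <;> cases v <;> simp [coalition]

theorem rep_mem_coalition (p v A B r) : rep r ∈ coalition (p, v, A, B) ↔ r ∈ B := by
  cases p <;> cases v <;> simp [coalition]

theorem coalition_bijective : Function.Bijective coalition := by
  constructor
  · rintro ⟨p, v, A, B⟩ ⟨p', v', A', B'⟩ h
    have hp : p = p' := by
      rw [Bool.eq_iff_iff, ← pres_mem_coalition p v A B, h, pres_mem_coalition]
    have hv : v = v' := by
      rw [Bool.eq_iff_iff, ← vp_mem_coalition p v A B, h, vp_mem_coalition]
    have hA : A = A' := by
      ext s
      rw [← sen_mem_coalition p v A B, h, sen_mem_coalition]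
    have hB : B = B' := by
      ext r
      rw [← rep_mem_coalition p v A B, h, rep_mem_coalition]
    rw [hp, hv, hA, hB]
  · intro S
    refine ⟨(decide (pres ∈ S), decide (vp ∈ S), Finset.univ.filter (sen · ∈ S),
      Finset.univ.filter (rep · ∈ S)), ?_⟩
    ext (_ | _ | s | r)
    · simp [pres_mem_coalition]
    · simp [vp_mem_coalition]
    · simp [sen_mem_coalition]
    · simp [rep_mem_coalition]

theorem card_coalition (p v A B) :
    (coalition (p, v, A, B)).card = p.toNat + v.toNat + A.card + B.card := by
  have hs : Function.Injective sen := fun _ _ h => by injection h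
  have hr : Function.Injective rep := fun _ _ h => by injection h
  unfold coalition
  rw [Finset.card_union_of_disjoint, Finset.card_union_of_disjoint,
    Finset.card_union_of_disjoint, Finset.card_image_of_injective _ hs,
    Finset.card_image_of_injective _ hr]
  · cases p <;> cases v <;> simp
  · cases p <;> cases v <;> simp
  · cases p <;> cases v <;> simp [Finset.disjoint_left]
  · cases p <;> cases v <;> simp [Finset.disjoint_left]

theorem numSen_coalition (p v A B) : numSen (coalition (p, v, A, B)) = A.card := by
  have hs : Function.Injective sen := fun _ _ h => by injection h
  rw [numSen, ← Finset.card_image_of_injective A hs]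
  congr 1
  ext (_ | _ | s | r) <;> rw [Finset.mem_filter] <;> simp [isSen, sen_mem_coalition]

theorem numRep_coalition (p v A B) : numRep (coalition (p, v, A, B)) = B.card := by
  have hr : Function.Injective rep := fun _ _ h => by injection h
  rw [numRep, ← Finset.card_image_of_injective B hr]
  congr 1
  ext (_ | _ | s | r) <;> rw [Finset.mem_filter] <;> simp [isRep, rep_mem_coalition]

theorem usWinning_coalition (p v A B) : usWinning (coalition (p, v, A, B)) ↔
    (p = true ∧ 218 ≤ B.card ∧ (51 ≤ A.card ∨ (v = true ∧ 50 ≤ A.card))) ∨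
      (67 ≤ A.card ∧ 290 ≤ B.card) := by
  rw [usWinning, pres_mem_coalition, vp_mem_coalition, numSen_coalition, numRep_coalition]

theorem coalition_erase_pres (p v A B) :
    (coalition (p, v, A, B)).erase pres = coalition (false, v, A, B) := by
  ext (_ | _ | s | r) <;>
    simp [pres_mem_coalition, vp_mem_coalition, sen_mem_coalition, rep_mem_coalition]

theorem coalition_erase_vp (p v A B) :
    (coalition (p, v, A, B)).erase vp = coalition (p, false, A, B) := by
  ext (_ | _ | s | r) <;>
    simp [pres_mem_coalition, vp_mem_coalition, sen_mem_coalition, rep_mem_coalition]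

theorem coalition_erase_sen (p v A B s) :
    (coalition (p, v, A, B)).erase (sen s) = coalition (p, v, A.erase s, B) := by
  ext (_ | _ | s | r) <;>
    simp [pres_mem_coalition, vp_mem_coalition, sen_mem_coalition, rep_mem_coalition]

theorem coalition_erase_rep (p v A B r) :
    (coalition (p, v, A, B)).erase (rep r) = coalition (p, v, A, B.erase r) := by
  ext (_ | _ | s | r) <;>
    simp [pres_mem_coalition, vp_mem_coalition, sen_mem_coalition, rep_mem_coalition]

/-- Counting coalitions according to the presence of the president and the vice president. -/
theorem ncard_coalitions (R : Finset USPlayer → Prop) :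
    Set.ncard {S | R S} = ∑ p : Bool, ∑ v : Bool,
      Set.ncard {x : Finset (Fin 100) × Finset (Fin 435) | R (coalition (p, v, x))} := by
  classical
  have h : {S | R S} = coalition '' {y | R (coalition y)} := by
    ext S
    obtain ⟨y, rfl⟩ := coalition_bijective.2 S
    simp [coalition_bijective.1.eq_iff]
  rw [h, Set.ncard_image_of_injective _ coalition_bijective.1]
  simp only [Set.ncard_eq_toFinset_card', Set.toFinset_ofPred, Finset.card_filter]
  rw [Fintype.sum_prod_type]
  simp only [Fintype.sum_prod_type]

end USPlayer

/-- The number of subsets `X` of `Fin n` with `|X| + c = k` and `m ≤ |X|`. -/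
noncomputable def numLarge (n m c k : ℕ) : ℕ :=
  Set.ncard {X : Finset (Fin n) | X.card + c = k ∧ m ≤ X.card}

theorem ncard_card_eq (n a : ℕ) : Set.ncard {X : Finset (Fin n) | X.card = a} = n.choose a := by
  have h : {X : Finset (Fin n) | X.card = a} =
      ↑(Finset.powersetCard a (Finset.univ : Finset (Fin n))) := by
    ext X
    simp [Finset.mem_powersetCard]
  rw [h, Set.ncard_coe_finset, Finset.card_powersetCard, Finset.card_univ, Fintype.card_fin]

theorem ncard_mem_card_eq {n : ℕ} (i : Fin n) (a : ℕ) :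
    Set.ncard {X : Finset (Fin n) | i ∈ X ∧ X.card = a + 1} = (n - 1).choose a := by
  have h : {X : Finset (Fin n) | i ∈ X ∧ X.card = a + 1} =
      insert i '' ↑(Finset.powersetCard a (Finset.univ.erase i)) := by
    ext X
    simp only [Set.mem_ofPred_eq, Set.mem_image, Finset.mem_coe, Finset.mem_powersetCard]
    constructor
    · rintro ⟨hi, hc⟩
      exact ⟨X.erase i, ⟨Finset.erase_subset_erase i (Finset.subset_univ X),
        by rw [Finset.card_erase_of_mem hi, hc, Nat.add_sub_cancel]⟩, Finset.insert_erase hi⟩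
    · rintro ⟨Y, ⟨hY, hc⟩, rfl⟩
      have hi : i ∉ Y := fun h => Finset.notMem_erase i _ (hY h)
      exact ⟨Finset.mem_insert_self i Y, by rw [Finset.card_insert_of_notMem hi, hc]⟩
  rw [h, Set.InjOn.ncard_image, Set.ncard_coe_finset, Finset.card_powersetCard,
    Finset.card_erase_of_mem (Finset.mem_univ i), Finset.card_univ, Fintype.card_fin]
  intro Y hY Z hZ hYZ
  have hi : ∀ W ∈ Finset.powersetCard a (Finset.univ.erase i), i ∉ W := fun W hW h =>
    Finset.notMem_erase i _ ((Finset.mem_powersetCard.1 hW).1 h)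
  rw [← Finset.erase_insert (hi Y hY), hYZ, Finset.erase_insert (hi Z hZ)]

theorem numLarge_of_le {n m c k : ℕ} (h : m + c ≤ k) : numLarge n m c k = n.choose (k - c) := by
  rw [numLarge, ← ncard_card_eq]
  congr 1
  ext X
  simp only [Set.mem_ofPred_eq]
  omega

theorem numLarge_of_lt {n m c k : ℕ} (h : k < m + c) : numLarge n m c k = 0 := by
  have : {X : Finset (Fin n) | X.card + c = k ∧ m ≤ X.card} = ∅ := by
    ext X
    simp only [Set.mem_ofPred_eq, Set.mem_empty_iff_false, iff_false]
    omega
  rw [numLarge, this, Set.ncard_empty]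

theorem usCrit_eq_sum (i : USPlayer) (k : ℕ) : usCrit i k = ∑ p : Bool, ∑ v : Bool,
    Set.ncard {x : Finset (Fin 100) × Finset (Fin 435) |
      (USPlayer.coalition (p, v, x)).card = k ∧ i ∈ USPlayer.coalition (p, v, x) ∧
        usWinning (USPlayer.coalition (p, v, x)) ∧
          ¬ usWinning ((USPlayer.coalition (p, v, x)).erase i)} :=
  USPlayer.ncard_coalitions _

open USPlayer in
theorem usCrit_sen (s : Fin 100) (k : ℕ) : usCrit (sen s) k =
    Nat.choose 100 50 * numLarge 435 218 52 k +
      (Nat.choose 99 66 * numLarge 435 290 67 k + Nat.choose 99 66 * numLarge 435 290 68 k) := by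
  have key : ∀ (p v : Bool) (a m c : ℕ),
      (∀ x y : ℕ, 1 ≤ x → ((p.toNat + v.toNat + x + y = k ∧
        ((p = true ∧ 218 ≤ y ∧ (51 ≤ x ∨ (v = true ∧ 50 ≤ x))) ∨ (67 ≤ x ∧ 290 ≤ y)) ∧
        ¬ ((p = true ∧ 218 ≤ y ∧ (51 ≤ x - 1 ∨ (v = true ∧ 50 ≤ x - 1))) ∨
          (67 ≤ x - 1 ∧ 290 ≤ y))) ↔ x = a + 1 ∧ y + c = k ∧ m ≤ y)) →
      Set.ncard {x : Finset (Fin 100) × Finset (Fin 435) |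
        (coalition (p, v, x)).card = k ∧ sen s ∈ coalition (p, v, x) ∧
          usWinning (coalition (p, v, x)) ∧ ¬ usWinning ((coalition (p, v, x)).erase (sen s))} =
        Nat.choose 99 a * numLarge 435 m c k := by
    intro p v a m c h
    rw [numLarge, ← ncard_mem_card_eq s a, ← Set.ncard_prod]
    congr 1
    ext ⟨A, B⟩
    simp only [Set.mem_ofPred_eq, Set.mem_prod, card_coalition, sen_mem_coalition,
      coalition_erase_sen, usWinning_coalition]
    by_cases hs : s ∈ A
    · have := h A.card B.card (Finset.card_pos.2 ⟨s, hs⟩)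
      simpa only [Finset.card_erase_of_mem hs, hs, true_and] using this
    · simp only [hs, false_and, and_false]
  rw [usCrit_eq_sum, Fintype.sum_bool, Fintype.sum_bool, Fintype.sum_bool,
    key true true 49 218 52, key true false 50 218 52, key false true 66 290 68,
    key false false 66 290 67, Nat.choose_succ_succ' 99 49]
  · ring
  all_goals
    intro x y hx
    simp only [Bool.toNat_true, Bool.toNat_false]
    grind

open USPlayer in
theorem usCrit_rep (r : Fin 435) (k : ℕ) : usCrit (rep r) k =
    Nat.choose 434 217 * (numLarge 100 51 219 k + numLarge 100 50 220 k) +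
      (Nat.choose 434 289 * numLarge 100 67 290 k +
        Nat.choose 434 289 * numLarge 100 67 291 k) := by
  have key : ∀ (p v : Bool) (b m c : ℕ),
      (∀ x y : ℕ, 1 ≤ y → ((p.toNat + v.toNat + x + y = k ∧
        ((p = true ∧ 218 ≤ y ∧ (51 ≤ x ∨ (v = true ∧ 50 ≤ x))) ∨ (67 ≤ x ∧ 290 ≤ y)) ∧
        ¬ ((p = true ∧ 218 ≤ y - 1 ∧ (51 ≤ x ∨ (v = true ∧ 50 ≤ x))) ∨
          (67 ≤ x ∧ 290 ≤ y - 1))) ↔ (x + c = k ∧ m ≤ x) ∧ y = b + 1)) →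
      Set.ncard {x : Finset (Fin 100) × Finset (Fin 435) |
        (coalition (p, v, x)).card = k ∧ rep r ∈ coalition (p, v, x) ∧
          usWinning (coalition (p, v, x)) ∧ ¬ usWinning ((coalition (p, v, x)).erase (rep r))} =
        Nat.choose 434 b * numLarge 100 m c k := by
    intro p v b m c h
    rw [mul_comm, numLarge, ← ncard_mem_card_eq r b, ← Set.ncard_prod]
    congr 1
    ext ⟨A, B⟩
    simp only [Set.mem_ofPred_eq, Set.mem_prod, card_coalition, rep_mem_coalition,
      coalition_erase_rep, usWinning_coalition]
    by_cases hr : r ∈ B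
    · have := h A.card B.card (Finset.card_pos.2 ⟨r, hr⟩)
      simpa only [Finset.card_erase_of_mem hr, hr, true_and] using this
    · simp only [hr, false_and, and_false]
  rw [usCrit_eq_sum, Fintype.sum_bool, Fintype.sum_bool, Fintype.sum_bool,
    key true true 217 50 220, key true false 217 51 219, key false true 289 67 291,
    key false false 289 67 290]
  · ring
  all_goals
    intro x y hx
    simp only [Bool.toNat_true, Bool.toNat_false]
    grind

open USPlayer in
theorem usCrit_vp_le (k : ℕ) :
    usCrit vp k ≤ Nat.choose 100 50 * numLarge 435 218 52 k := by
  have key : ∀ (p v : Bool), (p = false ∨ v = false) →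
      Set.ncard {x : Finset (Fin 100) × Finset (Fin 435) |
        (coalition (p, v, x)).card = k ∧ vp ∈ coalition (p, v, x) ∧
          usWinning (coalition (p, v, x)) ∧ ¬ usWinning ((coalition (p, v, x)).erase vp)} = 0 := by
    intro p v h
    rw [Set.ncard_eq_zero (Set.toFinite _)]
    ext ⟨A, B⟩
    simp only [Set.mem_ofPred_eq, card_coalition, vp_mem_coalition,
      coalition_erase_vp, usWinning_coalition, Set.mem_empty_iff_false]
    cases p <;> cases v <;> simp_all
  rw [usCrit_eq_sum, Fintype.sum_bool, Fintype.sum_bool, Fintype.sum_bool,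
    key true false (.inr rfl), key false true (.inl rfl), key false false (.inl rfl), numLarge,
    ← ncard_card_eq, ← Set.ncard_prod]
  refine Set.ncard_le_ncard ?_ (Set.toFinite _)
  rintro ⟨A, B⟩
  simp only [Set.mem_ofPred_eq, Set.mem_prod, card_coalition, vp_mem_coalition,
    coalition_erase_vp, usWinning_coalition, Bool.toNat_true]
  grind

open USPlayer in
theorem le_usCrit_pres (k : ℕ) :
    (Nat.choose 100 50 + Nat.choose 100 51) * numLarge 435 218 52 k +
      (Nat.choose 100 66 * numLarge 435 290 67 k + Nat.choose 100 66 * numLarge 435 290 68 k) ≤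
      usCrit pres k := by
  have key : ∀ (v : Bool) (a c : ℕ), (v = true ∧ a = 50 ∧ c = 68 ∨ v = false ∧ a = 51 ∧ c = 67) →
      Nat.choose 100 a * numLarge 435 218 52 k + Nat.choose 100 66 * numLarge 435 290 c k ≤
      Set.ncard {x : Finset (Fin 100) × Finset (Fin 435) |
        (coalition (true, v, x)).card = k ∧ pres ∈ coalition (true, v, x) ∧
          usWinning (coalition (true, v, x)) ∧
          ¬ usWinning ((coalition (true, v, x)).erase pres)} := by
    intro v a c h
    rw [numLarge, numLarge, ← ncard_card_eq, ← ncard_card_eq, ← Set.ncard_prod, ← Set.ncard_prod,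
      ← Set.ncard_union_eq ?_ (Set.toFinite _) (Set.toFinite _)]
    · refine Set.ncard_le_ncard ?_ (Set.toFinite _)
      rintro ⟨A, B⟩
      simp only [Set.mem_ofPred_eq, Set.mem_union, Set.mem_prod, card_coalition, pres_mem_coalition,
        coalition_erase_pres, usWinning_coalition, Bool.toNat_true]
      rcases h with ⟨rfl, rfl, rfl⟩ | ⟨rfl, rfl, rfl⟩ <;>
        simp only [Bool.toNat_true, Bool.toNat_false] <;> grind
    · rw [Set.disjoint_left]
      rintro ⟨A, B⟩
      simp only [Set.mem_ofPred_eq, Set.mem_prod]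
      omega
  rw [usCrit_eq_sum, Fintype.sum_bool, Fintype.sum_bool]
  have h₁ := key true 50 68 (by simp)
  have h₂ := key false 51 67 (by simp)
  rw [add_mul]
  omega

/-- An inequality between multiples of binomial coefficients propagates along a diagonal. -/
theorem mul_choose_lt_mul_choose {x y n m a b : ℕ} (hnm : n ≤ m) (ha : a ≤ n)
    (hab : (n - a) * (b + 1) ≤ (m - b) * (a + 1))
    (h : x * n.choose a < y * m.choose b) (j : ℕ) (hj : b + j ≤ m) :
    x * n.choose (a + j) < y * m.choose (b + j) := by
  induction j with
  | zero => exact h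
  | succ j ih =>
    specialize ih (by omega)
    have hn := Nat.choose_succ_right_eq n (a + j)
    have hm := Nat.choose_succ_right_eq m (b + j)
    have hc : (n - (a + j)) * (b + j + 1) ≤ (m - (b + j)) * (a + j + 1) := by
      rcases le_total n (a + j) with hna | hna
      · simp [Nat.sub_eq_zero_of_le hna]
      · obtain ⟨d, rfl⟩ := Nat.exists_eq_add_of_le hna
        obtain ⟨e, rfl⟩ := Nat.exists_eq_add_of_le hj
        have h₁ : a + j + d - a = j + d := by omega
        have h₂ : b + (j + 1) + e - b = j + 1 + e := by omega
        have h₃ : a + j + d - (a + j) = d := by omega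
        have h₄ : b + (j + 1) + e - (b + j) = 1 + e := by omega
        rw [h₁, h₂] at hab
        rw [h₃, h₄]
        nlinarith
    have hpos : 0 < (m - (b + j)) * (a + j + 1) := Nat.mul_pos (by omega) (by omega)
    refine lt_of_mul_lt_mul_right (a := (a + j + 1) * (b + j + 1)) ?_ (Nat.zero_le _)
    calc x * n.choose (a + (j + 1)) * ((a + j + 1) * (b + j + 1))
        = x * (n.choose (a + j + 1) * (a + j + 1)) * (b + j + 1) := by ring_nf
      _ = x * n.choose (a + j) * ((n - (a + j)) * (b + j + 1)) := by rw [hn]; ring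
      _ ≤ x * n.choose (a + j) * ((m - (b + j)) * (a + j + 1)) := Nat.mul_le_mul_left _ hc
      _ < y * m.choose (b + j) * ((m - (b + j)) * (a + j + 1)) :=
        Nat.mul_lt_mul_of_pos_right ih hpos
      _ = y * (m.choose (b + j + 1) * (b + j + 1)) * (a + j + 1) := by rw [hm]; ring
      _ = y * m.choose (b + (j + 1)) * ((a + j + 1) * (b + j + 1)) := by ring_nf

theorem override_lt (c k : ℕ) :
    Nat.choose 434 289 * numLarge 100 67 (290 + c) k <
      Nat.choose 99 66 * numLarge 435 290 (67 + c) k ∨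
    Nat.choose 434 289 * numLarge 100 67 (290 + c) k = 0 ∧
      Nat.choose 99 66 * numLarge 435 290 (67 + c) k = 0 := by
  rcases lt_or_ge k (357 + c) with hk | hk
  · rw [numLarge_of_lt (by omega), numLarge_of_lt (by omega)]
    simp
  · obtain ⟨j, rfl⟩ := Nat.exists_eq_add_of_le hk
    rw [numLarge_of_le (by omega), numLarge_of_le (by omega),
      show 357 + c + j - (290 + c) = 67 + j by omega,
      show 357 + c + j - (67 + c) = 290 + j by omega]
    rcases le_or_gt j 145 with hj | hj
    · left
      refine mul_choose_lt_mul_choose (by norm_num) (by norm_num) (by norm_num) ?_ j (by omega)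
      have h₁ := Nat.add_one_mul_choose_eq 434 289
      have h₂ := Nat.add_one_mul_choose_eq 99 66
      have h₃ : 0 < Nat.choose 434 289 := Nat.choose_pos (by norm_num)
      have h₄ : 0 < Nat.choose 99 66 := Nat.choose_pos (by norm_num)
      have h₅ : 0 < Nat.choose 434 289 * Nat.choose 99 66 := Nat.mul_pos h₃ h₄
      norm_num only at h₁ h₂
      generalize Nat.choose 434 289 = x at *
      generalize Nat.choose 99 66 = y at *
      generalize Nat.choose 435 290 = z at *
      generalize Nat.choose 100 67 = w at *
      have e₁ : x * w * 67 = 100 * (x * y) := by rw [mul_assoc, ← h₂]; ring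
      have e₂ : y * z * 290 = 435 * (x * y) := by rw [mul_assoc, ← h₁]; ring
      omega
    · right
      rw [Nat.choose_eq_zero_of_lt (show 100 < 67 + j by omega),
        Nat.choose_eq_zero_of_lt (show 435 < 290 + j by omega)]
      simp

theorem signed_lt (k : ℕ) :
    Nat.choose 434 217 * (numLarge 100 51 219 k + numLarge 100 50 220 k) <
      Nat.choose 100 50 * numLarge 435 218 52 k ∨
    Nat.choose 434 217 * (numLarge 100 51 219 k + numLarge 100 50 220 k) = 0 ∧
      Nat.choose 100 50 * numLarge 435 218 52 k = 0 := by
  rcases lt_or_ge k 270 with hk | hk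
  · rw [numLarge_of_lt (by omega), numLarge_of_lt (by omega), numLarge_of_lt (by omega)]
    simp
  · obtain ⟨j, rfl⟩ := Nat.exists_eq_add_of_le hk
    rw [numLarge_of_le (by omega), numLarge_of_le (by omega), numLarge_of_le (by omega),
      show 270 + j - 219 = 50 + j + 1 by omega, show 270 + j - 220 = 50 + j by omega,
      show 270 + j - 52 = 218 + j by omega, add_comm (Nat.choose 100 (50 + j + 1)),
      ← Nat.choose_succ_succ' 100 (50 + j), show 50 + j + 1 = 51 + j by omega]
    rcases le_or_gt j 217 with hj | hj
    · left
      refine mul_choose_lt_mul_choose (by norm_num) (by norm_num) (by norm_num) ?_ j (by omega)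
      have h₁ := Nat.add_one_mul_choose_eq 434 217
      have h₂ := Nat.add_one_mul_choose_eq 100 50
      have h₃ : 0 < Nat.choose 434 217 := Nat.choose_pos (by norm_num)
      have h₄ : 0 < Nat.choose 100 50 := Nat.choose_pos (by norm_num)
      have h₅ : 0 < Nat.choose 434 217 * Nat.choose 100 50 := Nat.mul_pos h₃ h₄
      norm_num only at h₁ h₂ ⊢
      generalize Nat.choose 434 217 = x at *
      generalize Nat.choose 100 50 = y at *
      generalize Nat.choose 435 218 = z at *
      generalize Nat.choose 101 51 = w at *
      have e₁ : x * w * 51 = 101 * (x * y) := by rw [mul_assoc, ← h₂]; ring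
      have e₂ : y * z * 218 = 435 * (x * y) := by rw [mul_assoc, ← h₁]; ring
      omega
    · right
      rw [Nat.choose_eq_zero_of_lt (show 100 + 1 < 51 + j by omega),
        Nat.choose_eq_zero_of_lt (show 435 < 218 + j by omega)]
      simp

theorem usCrit_rep_lt_sen (s : Fin 100) (r : Fin 435) (k : ℕ) :
    usCrit (.rep r) k < usCrit (.sen s) k ∨
      usCrit (.rep r) k = 0 ∧ usCrit (.sen s) k = 0 := by
  rw [usCrit_sen, usCrit_rep]
  have h₁ := signed_lt k
  have h₂ := override_lt 0 k
  have h₃ := override_lt 1 k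
  norm_num only at h₂ h₃
  omega

theorem usCrit_sen_lt_pres (s : Fin 100) (k : ℕ) :
    usCrit (.sen s) k < usCrit .pres k ∨ usCrit (.sen s) k = 0 := by
  have h := le_usCrit_pres k
  rw [usCrit_sen]
  have h₁ : 0 < Nat.choose 100 51 := Nat.choose_pos (by norm_num)
  have h₂ : 0 < Nat.choose 99 65 := Nat.choose_pos (by norm_num)
  rw [show Nat.choose 100 66 = Nat.choose 99 65 + Nat.choose 99 66 from
    Nat.choose_succ_succ' 99 65] at h
  generalize numLarge 435 218 52 k = t at *
  generalize numLarge 435 290 67 k = u at *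
  generalize numLarge 435 290 68 k = v at *
  rcases Nat.eq_zero_or_pos (t + (u + v)) with h₀ | h₀
  · obtain ⟨rfl, rfl, rfl⟩ : t = 0 ∧ u = 0 ∧ v = 0 := by omega
    simp
  · left
    refine lt_of_lt_of_le ?_ h
    have e₁ : t ≤ Nat.choose 100 51 * t := Nat.le_mul_of_pos_left t h₁
    have e₂ : u ≤ Nat.choose 99 65 * u := Nat.le_mul_of_pos_left u h₂
    have e₃ : v ≤ Nat.choose 99 65 * v := Nat.le_mul_of_pos_left v h₂
    rw [add_mul, add_mul, add_mul]
    omega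

theorem usPower_le {lam : ℕ → ℝ} (hpos : ∀ k ∈ Finset.Icc 1 537, 0 ≤ lam k) {i j : USPlayer}
    (h : ∀ k, usCrit i k ≤ usCrit j k) : usPower lam i ≤ usPower lam j :=
  Finset.sum_le_sum fun k hk => mul_le_mul_of_nonneg_left (by exact_mod_cast h k) (hpos k hk)

theorem usPower_lt {lam : ℕ → ℝ} (hpos : ∀ k ∈ Finset.Icc 1 537, 0 ≤ lam k) {i j l : USPlayer}
    (hl : usPower lam l ≠ 0) (h : ∀ k, usCrit i k ≤ usCrit j k)
    (hlt : ∀ k, usCrit l k ≠ 0 → usCrit i k < usCrit j k) : usPower lam i < usPower lam j := by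
  obtain ⟨k, hk, hne⟩ := Finset.exists_ne_zero_of_sum_ne_zero hl
  obtain ⟨hk₁, hk₂⟩ := mul_ne_zero_iff.1 hne
  refine Finset.sum_lt_sum
    (fun k hk => mul_le_mul_of_nonneg_left (by exact_mod_cast h k) (hpos k hk)) ⟨k, hk, ?_⟩
  exact mul_lt_mul_of_pos_left (by exact_mod_cast hlt k (by exact_mod_cast hk₂))
    (lt_of_le_of_ne (hpos k hk) hk₁.symm)

/-- Theorem 3 (a) of the paper: for any power index `Φ` (weighting vector `lam`) with
`Φ(P) ≠ 0` and `Φ(S) ≠ 0`, the president is ranked strictly above a senator, a senator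
strictly above a representative, and a senator at least as high as the vice president. -/
theorem us_power_index_ranking (lam : ℕ → ℝ)
    (hpos : ∀ k ∈ Finset.Icc 1 537, 0 ≤ lam k)
    (hsum : (∑ k ∈ Finset.Icc 1 537, lam k * (Nat.choose 536 (k - 1) : ℝ)) = 1)
    (s : Fin 100) (r : Fin 435)
    (hp : usPower lam USPlayer.pres ≠ 0)
    (hs : usPower lam (USPlayer.sen s) ≠ 0) :
    usPower lam USPlayer.pres > usPower lam (USPlayer.sen s) ∧
    usPower lam (USPlayer.sen s) > usPower lam (USPlayer.rep r) ∧
    usPower lam (USPlayer.sen s) ≥ usPower lam USPlayer.vp := by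
  refine ⟨usPower_lt hpos hs (fun k => ?_) fun k hk => ?_,
    usPower_lt hpos hs (fun k => ?_) fun k hk => ?_, usPower_le hpos fun k => ?_⟩
  · have := usCrit_sen_lt_pres s k
    omega
  · have := usCrit_sen_lt_pres s k
    omega
  · have := usCrit_rep_lt_sen s r k
    omega
  · have := usCrit_rep_lt_sen s r k
    omega
  · rw [usCrit_sen]
    exact (usCrit_vp_le k).trans (Nat.le_add_right _ _)
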